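/- Let df ≥ 2 be an integer and let 0 = ν_1 ≤ ν_2 ≤ ... ≤ ν_df < 1 with ν_df > 0, and set ρ_j := ν_j / ν_df for j = 1, ..., df. Let λ_1, ..., λ_df be nonnegative reals and suppose: if df = 2, that λ_1² + (1−ν_2) λ_2² ≥ ν_2 and (1−ν_2) λ_2² ≥ (1/2) ν_2; if df ≥ 3, that for every integer i ≥ 0, 1{i=0} λ_1² + Σ_{j=2}^{df−1} ρ_j^i (1−ν_j) λ_j² + (1−ν_df) λ_df² ≥ (ν_df/(i+1)) ( df − 2 − Σ_{j=2}^{df−1} ρ_j^{i+1} ). Define Q(λ_1,...,λ_df) := (1/2) Σ_{j=1}^{df} (√ν_j X_j + √(1−ν_j) λ_j)² with X_1,...,X_df independent standard normal random variables, c_j(λ_1,...,λ_df) := E[Q(λ_1,...,λ_df)^j]/j!, and c_j(0,...,0) the same quantity with all λ's equal to zero. Then for every integer m ≥ 3, Σ_{j > l ≥ 0, j+l = m} (j−l) · Γ(df/2)² / ( Γ(df/2 + j) Γ(df/2 + l) ) · [ c_j(λ_1,...,λ_df) c_l(0,...,0) − c_l(λ_1,...,λ_df) c_j(0,...,0) ]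 ≥ 0. -/

import Mathlib

open MeasureTheory ProbabilityTheory

noncomputable section

/-- The quadratic form `Q(λ) = (1/2) Σ_j (√ν_j X_j + √(1-ν_j) λ_j)²` evaluated at the
outcome `ω` of the `df` independent standard normal variables. -/
def Qform (df : ℕ) (ν lam : Fin df → ℝ) (ω : Fin df → ℝ) : ℝ :=
  (1 / 2) * ∑ j, (Real.sqrt (ν j) * ω j + Real.sqrt (1 - ν j) * lam j) ^ 2

/-- The product of `df` standard Gaussian measures on `ℝ`. -/
def gaussPi (df : ℕ) : Measure (Fin df → ℝ) :=
  Measure.pi fun _ => gaussianReal 0 1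

/-- `c_j(λ) = E[Q(λ)^j] / j!`. -/
def cCoef (df : ℕ) (ν lam : Fin df → ℝ) (l : ℕ) : ℝ :=
  (∫ ω, Qform df ν lam ω ^ l ∂gaussPi df) / Nat.factorial l

open PowerSeries

/-- The `n`-th moment of `N(a, v)` satisfies the Stein recurrence. -/
lemma gaussianReal_moment_succ_succ (a : ℝ) (v : NNReal) (n : ℕ) :
    ∫ x, x ^ (n + 2) ∂gaussianReal a v =
      a * ∫ x, x ^ (n + 1) ∂gaussianReal a v + (n + 1) * v * ∫ x, x ^ n ∂gaussianReal a v := by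
  set f : ℝ → ℝ := fun t => Real.exp (a * t + v * t ^ 2 / 2) with hf
  have hmoment : ∀ k, ∫ x, x ^ k ∂gaussianReal a v = iteratedDeriv k f 0 := fun k => by
    rw [hf, ← mgf_id_gaussianReal, iteratedDeriv_mgf_zero (by simp)]
    rfl
  have hsmooth : ContDiff ℝ ⊤ f := by fun_prop
  have hder : ∀ k t, HasDerivAt (iteratedDeriv k f) (iteratedDeriv (k + 1) f t) t := fun k t => by
    rw [iteratedDeriv_succ]
    exact ((hsmooth.differentiable_iteratedDeriv k (by simp)) t).hasDerivAt
  have hone : ∀ t, iteratedDeriv 1 f t = (a + v * t) * f t := fun t => by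
    have h : HasDerivAt f (Real.exp (a * t + v * t ^ 2 / 2) * (a * 1 + v * (2 * t) / 2)) t := by
      refine HasDerivAt.exp (((hasDerivAt_id t).const_mul a).add ?_)
      simpa using ((hasDerivAt_pow 2 t).const_mul (v : ℝ)).div_const 2
    rw [iteratedDeriv_one, h.deriv]
    simp only [hf]
    ring
  have hlin : ∀ t : ℝ, HasDerivAt (fun t => a + v * t) v t := fun t => by
    simpa using ((hasDerivAt_id t).const_mul (v : ℝ)).const_add a
  have hrec : ∀ k t, iteratedDeriv (k + 2) f t =
      (a + v * t) * iteratedDeriv (k + 1) f t + (k + 1) * v * iteratedDeriv k f t := by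
    intro k
    induction k with
    | zero =>
      intro t
      have h := (hlin t).mul (hder 0 t)
      have h' := hder 1 t
      rw [show iteratedDeriv 1 f = fun t => (a + v * t) * f t from funext hone] at h'
      rw [iteratedDeriv_zero] at h
      rw [h'.unique h]
      simp only [zero_add, iteratedDeriv_zero]
      push_cast
      ring
    | succ k ih =>
      intro t
      have h := ((hlin t).mul (hder (k + 1) t)).add ((hder k t).const_mul ((k + 1) * v : ℝ))
      have h' := hder (k + 2) t
      rw [show iteratedDeriv (k + 2) f = fun t => (a + v * t) * iteratedDeriv (k + 1) f t +
        (k + 1) * v * iteratedDeriv k f t from funext ih] at h'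
      rw [h'.unique h]
      push_cast
      ring
  simp only [hmoment, hrec n 0]
  ring

/-- The exponential generating series of the moments of `Y² / 2` with `Y ∼ N(a, v)`. -/
def halfSqSeries (a : ℝ) (v : NNReal) : ℝ⟦X⟧ :=
  PowerSeries.mk fun n => (∫ x, (x ^ 2 / 2) ^ n ∂gaussianReal a v) / n.factorial

/-- The logarithmic derivative of `halfSqSeries a v`. -/
def halfSqLogDeriv (a v : ℝ) : ℝ⟦X⟧ :=
  PowerSeries.mk fun i => (v ^ (i + 1) + (i + 1) * v ^ i * a ^ 2) / 2

lemma coeff_one_sub_C_mul_X_mul_zero (v : ℝ) (f : ℝ⟦X⟧) :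
    coeff 0 ((1 - C v * X) * f) = coeff 0 f := by
  simp

lemma coeff_one_sub_C_mul_X_mul_succ (v : ℝ) (f : ℝ⟦X⟧) (n : ℕ) :
    coeff (n + 1) ((1 - C v * X) * f) = coeff (n + 1) f - v * coeff n f := by
  rw [sub_mul, one_mul, map_sub, mul_assoc, coeff_C_mul, coeff_succ_X_mul]

lemma coeff_halfSqSeries (a : ℝ) (v : NNReal) (n : ℕ) :
    coeff n (halfSqSeries a v) =
      (∫ x, x ^ (2 * n) ∂gaussianReal a v) / (2 ^ n * n.factorial) := by
  simp only [halfSqSeries, coeff_mk, div_mul_eq_div_div, div_pow, ← pow_mul, integral_div]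

lemma derivative_halfSqSeries (a : ℝ) (v : NNReal) :
    d⁄dX ℝ (halfSqSeries a v) = halfSqLogDeriv a v * halfSqSeries a v := by
  have hne : (1 - C (v : ℝ) * X : ℝ⟦X⟧) ≠ 0 := fun h => by
    simpa using congrArg (coeff 0) h
  have hD : (1 - C (v : ℝ) * X) * ((1 - C (v : ℝ) * X) * halfSqLogDeriv a v) =
      C (((v : ℝ) + a ^ 2) / 2) - C ((v : ℝ) ^ 2 / 2) * X := by
    ext n
    rcases n with _ | _ | n
    · simp [halfSqLogDeriv]
    · simp only [coeff_one_sub_C_mul_X_mul_succ, zero_add, coeff_one_sub_C_mul_X_mul_zero,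
        halfSqLogDeriv, coeff_mk, map_sub, coeff_C_mul, coeff_one_X, coeff_C]
      simp
      ring
    · simp only [coeff_one_sub_C_mul_X_mul_succ,
        halfSqLogDeriv, coeff_mk, map_sub, coeff_C_mul, coeff_X, coeff_C]
      simp
      ring
  have hF : (1 - C (v : ℝ) * X) * ((1 - C (v : ℝ) * X) * d⁄dX ℝ (halfSqSeries a v)) =
      C (((v : ℝ) + a ^ 2) / 2) * halfSqSeries a v -
        C ((v : ℝ) ^ 2 / 2) * (X * halfSqSeries a v) := by
    have h0 : ∫ x, x ^ 0 ∂gaussianReal a v = 1 := by simp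
    have h1 : ∫ x, x ^ 1 ∂gaussianReal a v = a := by simp
    ext n
    rcases n with _ | _ | n
    · have h2 := gaussianReal_moment_succ_succ a v 0
      rw [map_sub, coeff_C_mul, coeff_C_mul, coeff_zero_X_mul]
      simp only [zero_add, h0, h1] at h2
      simp only [coeff_one_sub_C_mul_X_mul_zero, coeff_derivative, coeff_halfSqSeries,
        mul_zero, zero_add, h0, mul_one, h2]
      simp
      ring
    · have h2 := gaussianReal_moment_succ_succ a v 0
      have h3 := gaussianReal_moment_succ_succ a v 1
      have h4 := gaussianReal_moment_succ_succ a v 2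
      rw [map_sub, coeff_C_mul, coeff_C_mul, coeff_succ_X_mul]
      norm_num at h0 h1 h2 h3 h4
      simp only [coeff_one_sub_C_mul_X_mul_succ, coeff_one_sub_C_mul_X_mul_zero, coeff_derivative,
        coeff_halfSqSeries]
      norm_num [h0, h1, h2, h3, h4, Nat.factorial]
      ring
    · have h3 := gaussianReal_moment_succ_succ a v (2 * n + 2)
      have h4 := gaussianReal_moment_succ_succ a v (2 * n + 3)
      have h5 := gaussianReal_moment_succ_succ a v (2 * n + 4)
      rw [map_sub, coeff_C_mul, coeff_C_mul, coeff_succ_X_mul]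
      simp only [coeff_one_sub_C_mul_X_mul_succ, coeff_derivative, coeff_halfSqSeries]
      have e1 : 2 * (n + 1) = 2 * n + 2 := by ring
      have e2 : 2 * (n + 1 + 1) = 2 * n + 4 := by ring
      have e3 : 2 * (n + 1 + 1 + 1) = 2 * n + 6 := by ring
      rw [e1, e2, e3]
      simp only [Nat.add_assoc, Nat.reduceAdd] at h3 h4 h5 ⊢
      have hfac : (n.factorial : ℝ) ≠ 0 := by positivity
      have f1 : ((n + 1).factorial : ℝ) = (n + 1) * n.factorial := by
        rw [Nat.factorial_succ]; push_cast; ring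
      have f2 : ((n + 2).factorial : ℝ) = (n + 2) * ((n + 1) * n.factorial) := by
        rw [Nat.factorial_succ]; push_cast [f1]; ring
      have f3 : ((n + 3).factorial : ℝ) = (n + 3) * ((n + 2) * ((n + 1) * n.factorial)) := by
        rw [Nat.factorial_succ]; push_cast [f2]; ring
      push_cast at h3 h4 h5
      have h6 : ∫ x, x ^ (2 * n + 6) ∂gaussianReal a v =
          (a ^ 2 + v * (4 * n + 9)) * ∫ x, x ^ (2 * n + 4) ∂gaussianReal a v -
          (2 * n + 4) * (2 * n + 3) * v ^ 2 * ∫ x, x ^ (2 * n + 2) ∂gaussianReal a v := by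
        linear_combination h5 + a * h4 - v * (2 * n + 4) * h3
      rw [h6, f1, f2, f3]
      push_cast
      field_simp
      ring
  apply mul_left_cancel₀ hne
  apply mul_left_cancel₀ hne
  linear_combination hF - halfSqSeries a v * hD

lemma derivative_prod_of_eq_mul {ι : Type*} (s : Finset ι) (f g : ι → ℝ⟦X⟧)
    (h : ∀ i ∈ s, d⁄dX ℝ (f i) = g i * f i) :
    d⁄dX ℝ (∏ i ∈ s, f i) = (∑ i ∈ s, g i) * ∏ i ∈ s, f i := by
  classical
  induction s using Finset.induction_on with
  | empty => simp
  | insert a s ha ih =>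
    rw [Finset.prod_insert ha, Finset.sum_insert ha, Derivation.leibniz,
      ih fun i hi => h i (Finset.mem_insert_of_mem hi), h a (Finset.mem_insert_self a s),
      smul_eq_mul, smul_eq_mul]
    ring

lemma sum_pow_div_factorial_eq {ι : Type*} [DecidableEq ι] (s : Finset ι) (y : ι → ℝ) (n : ℕ) :
    (∑ i ∈ s, y i) ^ n / n.factorial =
      ∑ k ∈ Finset.finsuppAntidiag s n, ∏ i ∈ s, y i ^ k i / (k i).factorial := by
  have hprod : ∏ i ∈ s, rescale (y i) (exp ℝ) = rescale (∑ i ∈ s, y i) (exp ℝ) := by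
    induction s using Finset.induction_on with
    | empty => ext n; cases n <;> simp [coeff_one]
    | insert a s ha ih =>
      rw [Finset.prod_insert ha, Finset.sum_insert ha, ih, exp_mul_exp_eq_exp_add]
  have h := congrArg (coeff n) hprod
  rw [coeff_prod, coeff_rescale, coeff_exp] at h
  simp only [coeff_rescale, coeff_exp] at h
  simpa [div_eq_mul_inv] using h.symm

lemma map_affine_gaussianReal (a : ℝ) (v : NNReal) :
    (gaussianReal 0 1).map (fun x => Real.sqrt v * x + a) = gaussianReal a v := by
  have h : (fun x => Real.sqrt v * x + a) = (· + a) ∘ (Real.sqrt v * ·) := rfl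
  rw [h, ← Measure.map_map (by fun_prop) (by fun_prop), gaussianReal_map_const_mul,
    gaussianReal_map_add_const]
  congr 1
  · simp
  · ext
    simp

lemma integrable_half_sq_pow_gaussianReal (a : ℝ) (v : NNReal) (n : ℕ) :
    Integrable (fun x => (x ^ 2 / 2) ^ n) (gaussianReal a v) := by
  have h := (memLp_id_gaussianReal (μ := a) (v := v) (2 * n : ℕ)).integrable_norm_pow'
  refine (h.div_const (2 ^ n)).congr (ae_of_all _ fun x => ?_)
  simp [div_pow, pow_mul]

lemma cCoef_eq_coeff_prod (df : ℕ) (v : Fin df → NNReal) (lam : Fin df → ℝ) (n : ℕ) :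
    cCoef df (fun j => v j) lam n =
      coeff n (∏ j, halfSqSeries (Real.sqrt (1 - v j) * lam j) (v j)) := by
  classical
  set a : Fin df → ℝ := fun j => Real.sqrt (1 - v j) * lam j
  have hint : ∀ j k, Integrable
      (fun x => ((Real.sqrt (v j) * x + a j) ^ 2 / 2) ^ k / (k.factorial : ℝ))
      (gaussianReal 0 1) := fun j k => by
    have h := integrable_half_sq_pow_gaussianReal (a j) (v j) k
    rw [← map_affine_gaussianReal, integrable_map_measure (by fun_prop) (by fun_prop)] at h
    exact h.div_const _
  have hval : ∀ j k,
      ∫ x, ((Real.sqrt (v j) * x + a j) ^ 2 / 2) ^ k / (k.factorial : ℝ) ∂gaussianReal 0 1 =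
        coeff k (halfSqSeries (a j) (v j)) := fun j k => by
    rw [halfSqSeries, coeff_mk, integral_div]
    conv_rhs => rw [← map_affine_gaussianReal, integral_map (by fun_prop) (by fun_prop)]
  rw [cCoef, ← integral_div, coeff_prod]
  have hpt : ∀ ω, Qform df (fun j => v j) lam ω ^ n / n.factorial =
      ∑ k ∈ Finset.finsuppAntidiag Finset.univ n,
        ∏ j, ((Real.sqrt (v j) * ω j + a j) ^ 2 / 2) ^ k j / ((k j).factorial : ℝ) := fun ω => by
    rw [← sum_pow_div_factorial_eq, Qform, ← Finset.sum_div, one_div_mul_eq_div]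
  simp only [hpt, gaussPi]
  rw [integral_finsetSum _ fun k _ => Integrable.fintype_prod fun j => hint j (k j)]
  refine Finset.sum_congr rfl fun k _ => ?_
  rw [integral_fintype_prod_eq_prod
    (f := fun j x => ((Real.sqrt (v j) * x + a j) ^ 2 / 2) ^ k j / ((k j).factorial : ℝ))]
  exact Finset.prod_congr rfl fun j _ => hval j (k j)

lemma coeff_mul_nonneg {f g : ℝ⟦X⟧} (hf : ∀ n, 0 ≤ coeff n f) (hg : ∀ n, 0 ≤ coeff n g) (n : ℕ) :
    0 ≤ coeff n (f * g) := by
  rw [coeff_mul]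
  exact Finset.sum_nonneg fun p _ => mul_nonneg (hf _) (hg _)

/-- A solution of `f' = g f` with `f(0) ≥ 0` and `g` coefficientwise nonnegative is
coefficientwise nonnegative. -/
lemma coeff_nonneg_of_derivative_eq_mul {f g : ℝ⟦X⟧} (h : d⁄dX ℝ f = g * f)
    (h0 : 0 ≤ coeff 0 f) (hg : ∀ n, 0 ≤ coeff n g) (n : ℕ) : 0 ≤ coeff n f := by
  induction n using Nat.strong_induction_on with
  | _ n ih =>
    rcases n with _ | n
    · exact h0
    · have hn := congrArg (coeff n) h
      rw [coeff_derivative, coeff_mul] at hn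
      refine nonneg_of_mul_nonneg_left (b := (n : ℝ) + 1) ?_ (by positivity)
      rw [hn]
      refine Finset.sum_nonneg fun p hp => mul_nonneg (hg _) (ih _ ?_)
      have := Finset.HasAntidiagonal.mem_antidiagonal.mp hp
      omega

lemma coeff_one_sub_mul_derivative_sub (w β : ℝ) (f : ℝ⟦X⟧) (n : ℕ) :
    coeff n ((1 - C w * X) * d⁄dX ℝ f - C (β * w) * f) =
      (n + 1) * coeff (n + 1) f - (β + n) * w * coeff n f := by
  rw [map_sub, coeff_C_mul]
  rcases n with _ | n
  · rw [coeff_one_sub_C_mul_X_mul_zero, coeff_derivative]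
    push_cast
    ring
  · rw [coeff_one_sub_C_mul_X_mul_succ, coeff_derivative, coeff_derivative]
    push_cast
    ring

/-- If the logarithmic derivative of `f` dominates that of `(1 - w X)^(-β)` coefficientwise and
`β ≥ 1`, then the ratios of successive coefficients of `f` dominate those of `(1 - w X)^(-β)`. -/
lemma le_coeff_succ_of_logDeriv_ge {f D : ℝ⟦X⟧} {w β : ℝ} (hw : 0 ≤ w) (hβ : 1 ≤ β)
    (h : d⁄dX ℝ f = D * f) (h0 : 0 ≤ coeff 0 f) (hD : ∀ i, β * w ^ (i + 1) ≤ coeff i D) (n : ℕ) :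
    (β + n) * w * coeff n f ≤ (n + 1) * coeff (n + 1) f := by
  set L : ℝ⟦X⟧ := PowerSeries.mk fun i => w ^ (i + 1) with hL
  have hgeom : (1 - C w * X) * L = C w := by
    ext i
    rcases i with _ | i
    · simp [hL]
    · rw [coeff_one_sub_C_mul_X_mul_succ, hL, coeff_mk, coeff_mk, coeff_C]
      simp
      ring
  have hK' : d⁄dX ℝ ((1 - C w * X) * f) = (D - L) * ((1 - C w * X) * f) := by
    have hlin : d⁄dX ℝ (1 - C w * X : ℝ⟦X⟧) = -C w := by
      rw [map_sub, Derivation.leibniz]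
      simp
    rw [Derivation.leibniz, hlin, h, smul_eq_mul, smul_eq_mul]
    linear_combination f * hgeom
  have hK : ∀ i, 0 ≤ coeff i ((1 - C w * X) * f) := by
    refine coeff_nonneg_of_derivative_eq_mul hK' (by simpa using h0) fun i => ?_
    rw [map_sub, hL, coeff_mk, sub_nonneg]
    exact le_trans (le_mul_of_one_le_left (by positivity) hβ) (hD i)
  have hE : ∀ i, 0 ≤ coeff i (D - C β * L) := fun i => by
    rw [map_sub, coeff_C_mul, hL, coeff_mk, sub_nonneg]
    exact hD i
  have hmain := coeff_mul_nonneg hE hK n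
  have hfac : (D - C β * L) * ((1 - C w * X) * f) =
      (1 - C w * X) * d⁄dX ℝ f - C (β * w) * f := by
    rw [h, map_mul]
    linear_combination -C β * f * hgeom
  rw [hfac, coeff_one_sub_mul_derivative_sub] at hmain
  linarith

lemma coeff_succ_le_of_logDeriv_le {f D : ℝ⟦X⟧} {w β : ℝ}
    (h : d⁄dX ℝ f = D * f) (hf : ∀ n, 0 ≤ coeff n f) (h0 : coeff 0 D ≤ β * w)
    (hD : ∀ i, coeff (i + 1) D ≤ w * coeff i D) (n : ℕ) :
    (n + 1) * coeff (n + 1) f ≤ (β + n) * w * coeff n f := by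
  have hE : ∀ i, 0 ≤ coeff i (C (β * w) - (1 - C w * X) * D) := fun i => by
    rcases i with _ | i
    · rw [map_sub, coeff_one_sub_C_mul_X_mul_zero, coeff_C]
      simpa using h0
    · rw [map_sub, coeff_one_sub_C_mul_X_mul_succ, coeff_C]
      simpa using hD i
  have hmain := coeff_mul_nonneg hE hf n
  have hfac : (C (β * w) - (1 - C w * X) * D) * f =
      -((1 - C w * X) * d⁄dX ℝ f - C (β * w) * f) := by
    rw [h]
    ring
  rw [hfac, map_neg, coeff_one_sub_mul_derivative_sub] at hmain
  linarith

lemma mul_le_mul_of_ratio_bounds {x y r : ℕ → ℝ} (hx : ∀ n, 0 ≤ x n) (hy : ∀ n, 0 ≤ y n)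
    (hr : ∀ n, 0 ≤ r n) (hxr : ∀ n, r n * x n ≤ (n + 1) * x (n + 1))
    (hyr : ∀ n, (n + 1) * y (n + 1) ≤ r n * y n) {l j : ℕ} (hlj : l ≤ j) :
    x l * y j ≤ x j * y l := by
  induction j, hlj using Nat.le_induction with
  | base => exact le_rfl
  | succ j _ ih =>
    have hpos : (0 : ℝ) < j + 1 := by positivity
    refine le_of_mul_le_mul_left ?_ hpos
    calc (j + 1 : ℝ) * (x l * y (j + 1)) = x l * ((j + 1) * y (j + 1)) := by ring
      _ ≤ x l * (r j * y j) := mul_le_mul_of_nonneg_left (hyr j) (hx l)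
      _ = r j * (x l * y j) := by ring
      _ ≤ r j * (x j * y l) := mul_le_mul_of_nonneg_left ih (hr j)
      _ = (r j * x j) * y l := by ring
      _ ≤ ((j + 1) * x (j + 1)) * y l := mul_le_mul_of_nonneg_right (hxr j) (hy l)
      _ = (j + 1 : ℝ) * (x (j + 1) * y l) := by ring

lemma cCoef_nonneg (df : ℕ) (ν lam : Fin df → ℝ) (n : ℕ) : 0 ≤ cCoef df ν lam n := by
  refine div_nonneg (integral_nonneg fun ω => pow_nonneg ?_ n) (by positivity)
  exact mul_nonneg (by norm_num) (Finset.sum_nonneg fun j _ => sq_nonneg _)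

/-- The generating series of `cCoef df ν lam`. -/
def cSeries (df : ℕ) (ν lam : Fin df → ℝ) : ℝ⟦X⟧ :=
  PowerSeries.mk (cCoef df ν lam)

lemma derivative_cSeries (df : ℕ) (ν lam : Fin df → ℝ) (hν : ∀ j, 0 ≤ ν j) :
    d⁄dX ℝ (cSeries df ν lam) =
      (∑ j, halfSqLogDeriv (Real.sqrt (1 - ν j) * lam j) (ν j)) * cSeries df ν lam := by
  lift ν to Fin df → NNReal using hν
  have hprod : cSeries df (fun j => ν j) lam =
      ∏ j, halfSqSeries (Real.sqrt (1 - ν j) * lam j) (ν j) := by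
    ext n
    rw [cSeries, coeff_mk, cCoef_eq_coeff_prod]
  rw [hprod]
  exact derivative_prod_of_eq_mul _ _ _ fun j _ => derivative_halfSqSeries _ _

lemma coeff_sum_halfSqLogDeriv {df : ℕ} {ν : Fin df → ℝ} (lam : Fin df → ℝ) (hν : ∀ j, ν j ≤ 1)
    (i : ℕ) :
    coeff i (∑ j, halfSqLogDeriv (Real.sqrt (1 - ν j) * lam j) (ν j)) =
      ∑ j, (ν j ^ (i + 1) + (i + 1) * (ν j ^ i * (1 - ν j) * lam j ^ 2)) / 2 := by
  rw [map_sum]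
  refine Finset.sum_congr rfl fun j _ => ?_
  rw [halfSqLogDeriv, coeff_mk, mul_pow, Real.sq_sqrt (by linarith [hν j])]
  ring

lemma sum_univ_eq_first_add_middle_add_last {df : ℕ} (hdf : 2 ≤ df) (hfirst : 0 < df)
    (hlast : df - 1 < df) (f : Fin df → ℝ) :
    ∑ j, f j = f ⟨0, hfirst⟩ +
      ∑ j ∈ Finset.univ.filter (fun j : Fin df => 1 ≤ (j : ℕ) ∧ (j : ℕ) ≤ df - 2), f j +
      f ⟨df - 1, hlast⟩ := by
  have hset : (Finset.univ : Finset (Fin df)) = insert ⟨0, hfirst⟩ (insert ⟨df - 1, hlast⟩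
      (Finset.univ.filter fun j : Fin df => 1 ≤ (j : ℕ) ∧ (j : ℕ) ≤ df - 2)) := by
    ext j
    simp only [Finset.mem_univ, Finset.mem_insert, Finset.mem_filter, Fin.ext_iff, true_and,
      true_iff]
    omega
  conv_lhs => rw [hset]
  rw [Finset.sum_insert, Finset.sum_insert]
  · ring
  · simp only [Finset.mem_filter, not_and, Finset.mem_univ, true_and]
    omega
  · simp only [Finset.mem_filter, Finset.mem_insert, Fin.ext_iff, Finset.mem_univ, true_and]
    omega

theorem statement15 (df : ℕ) (hdf : 2 ≤ df)
    (ν : Fin df → ℝ) (hmono : Monotone ν)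
    (hfirst : ν ⟨0, by omega⟩ = 0)
    (hlast_lt : ν ⟨df - 1, by omega⟩ < 1)
    (hlast_pos : 0 < ν ⟨df - 1, by omega⟩)
    (ρ : Fin df → ℝ) (hρ : ∀ j, ρ j = ν j / ν ⟨df - 1, by omega⟩)
    (lam : Fin df → ℝ) (hlam : ∀ j, 0 ≤ lam j)
    (hcond2 : df = 2 →
      ν ⟨1, by omega⟩ ≤
          lam ⟨0, by omega⟩ ^ 2 + (1 - ν ⟨1, by omega⟩) * lam ⟨1, by omega⟩ ^ 2 ∧
        (1 / 2) * ν ⟨1, by omega⟩ ≤ (1 - ν ⟨1, by omega⟩) * lam ⟨1, by omega⟩ ^ 2)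
    (hcond3 : 3 ≤ df → ∀ i : ℕ,
      (ν ⟨df - 1, by omega⟩ / ((i : ℝ) + 1)) *
          ((df : ℝ) - 2 -
            ∑ j ∈ Finset.univ.filter
                (fun j : Fin df => 1 ≤ (j : ℕ) ∧ (j : ℕ) ≤ df - 2),
              ρ j ^ (i + 1)) ≤
        (if i = 0 then lam ⟨0, by omega⟩ ^ 2 else 0) +
          (∑ j ∈ Finset.univ.filter
              (fun j : Fin df => 1 ≤ (j : ℕ) ∧ (j : ℕ) ≤ df - 2),
            ρ j ^ i * (1 - ν j) * lam j ^ 2) +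
          (1 - ν ⟨df - 1, by omega⟩) * lam ⟨df - 1, by omega⟩ ^ 2) :
    ∀ m : ℕ, 3 ≤ m →
      0 ≤ ∑ l ∈ (Finset.range (m + 1)).filter (fun l => 2 * l < m),
          ((m : ℝ) - 2 * (l : ℝ)) * Real.Gamma ((df : ℝ) / 2) ^ 2 /
              (Real.Gamma ((df : ℝ) / 2 + ((m - l : ℕ) : ℝ)) *
                Real.Gamma ((df : ℝ) / 2 + (l : ℝ))) *
            (cCoef df ν lam (m - l) * cCoef df ν (fun _ => 0) l -
              cCoef df ν lam l * cCoef df ν (fun _ => 0) (m - l)) := by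
  have hdf0 : 0 < df := by omega
  have hlast : df - 1 < df := by omega
  set w := ν ⟨df - 1, hlast⟩ with hw
  have hν0 : ∀ j, 0 ≤ ν j := fun j => by
    rw [← hfirst]
    exact hmono (Fin.mk_le_of_le_val (Nat.zero_le _))
  have hνw : ∀ j, ν j ≤ w := fun j => hmono (Fin.le_def.mpr (by simp; omega))
  have hν1 : ∀ j, ν j ≤ 1 := fun j => (hνw j).trans hlast_lt.le
  have hdfR : (2 : ℝ) ≤ df := by exact_mod_cast hdf
  have hsucc : ∀ n : ℕ, (((df : ℝ) - 1) / 2 + n) * w * cCoef df ν lam n ≤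
      (n + 1) * cCoef df ν lam (n + 1) := by
    obtain ⟨β, hβ1, hβ, hlow⟩ : ∃ β : ℝ, 1 ≤ β ∧ ((df : ℝ) - 1) / 2 ≤ β ∧ ∀ i : ℕ,
        β * w ^ (i + 1) ≤
          coeff i (∑ j, halfSqLogDeriv (Real.sqrt (1 - ν j) * lam j) (ν j)) := by
      simp only [coeff_sum_halfSqLogDeriv lam hν1]
      rcases hdf.eq_or_lt with h2 | h3
      · subst h2
        obtain ⟨hc1, hc2⟩ := hcond2 rfl
        refine ⟨1, le_rfl, by norm_num, fun i => ?_⟩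
        have hw' : ν 1 = w := rfl
        have h0' : ν 0 = 0 := hfirst
        change w ≤ lam 0 ^ 2 + (1 - w) * lam 1 ^ 2 at hc1
        change 1 / 2 * w ≤ (1 - w) * lam 1 ^ 2 at hc2
        rw [Fin.sum_univ_two, hw', h0']
        rcases i with _ | i
        · norm_num
          linarith
        · have hwi : 0 ≤ w ^ (i + 1) := by positivity
          have hi : (0 : ℝ) ≤ i := i.cast_nonneg
          have h := mul_le_mul_of_nonneg_left hc2 hwi
          have h' := mul_le_mul_of_nonneg_left h (by positivity : (0 : ℝ) ≤ i + 2)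
          have h'' : 0 ≤ i * (w ^ (i + 1) * w) := by positivity
          push_cast
          rw [pow_succ w (i + 1)]
          simp
          linarith
      · refine ⟨((df : ℝ) - 1) / 2, ?_, le_rfl, fun i => ?_⟩
        · have : (3 : ℝ) ≤ df := by exact_mod_cast h3
          linarith
        · have hc := hcond3 h3 i
          have hwi : 0 ≤ w ^ i * (i + 1) / 2 := by positivity
          have h := mul_le_mul_of_nonneg_left hc hwi
          have hρw : ∀ j, ρ j * w = ν j := fun j => by
            rw [hρ, div_mul_cancel₀ _ hlast_pos.ne']
          have hs1 : w ^ (i + 1) * ∑ j ∈ Finset.univ.filter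
              (fun j : Fin df => 1 ≤ (j : ℕ) ∧ (j : ℕ) ≤ df - 2), ρ j ^ (i + 1) =
              ∑ j ∈ Finset.univ.filter
              (fun j : Fin df => 1 ≤ (j : ℕ) ∧ (j : ℕ) ≤ df - 2), ν j ^ (i + 1) := by
            rw [Finset.mul_sum]
            refine Finset.sum_congr rfl fun j _ => ?_
            rw [← hρw j, mul_pow, mul_comm]
          have hs2 : w ^ i * ∑ j ∈ Finset.univ.filter
              (fun j : Fin df => 1 ≤ (j : ℕ) ∧ (j : ℕ) ≤ df - 2), ρ j ^ i * (1 - ν j) * lam j ^ 2 =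
              ∑ j ∈ Finset.univ.filter
              (fun j : Fin df => 1 ≤ (j : ℕ) ∧ (j : ℕ) ≤ df - 2),
                ν j ^ i * (1 - ν j) * lam j ^ 2 := by
            rw [Finset.mul_sum]
            refine Finset.sum_congr rfl fun j _ => ?_
            have hpow : ν j ^ i = w ^ i * ρ j ^ i := by rw [← hρw j, mul_pow, mul_comm]
            rw [hpow]
            ring
          have hfirst_term : w ^ i * (if i = 0 then lam ⟨0, hdf0⟩ ^ 2 else 0) =
              (0 : ℝ) ^ i * lam ⟨0, hdf0⟩ ^ 2 := by
            rcases i with _ | i <;> simp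
          have hlhs : w ^ i * ((i : ℝ) + 1) / 2 * (w / ((i : ℝ) + 1) * ((df : ℝ) - 2 -
              ∑ j ∈ Finset.univ.filter
                (fun j : Fin df => 1 ≤ (j : ℕ) ∧ (j : ℕ) ≤ df - 2), ρ j ^ (i + 1))) =
              (((df : ℝ) - 2) * w ^ (i + 1) - ∑ j ∈ Finset.univ.filter
                (fun j : Fin df => 1 ≤ (j : ℕ) ∧ (j : ℕ) ≤ df - 2), ν j ^ (i + 1)) / 2 := by
            rw [← hs1]
            field_simp
            ring
          rw [hlhs] at h
          rw [← Finset.sum_div, Finset.sum_add_distrib, ← Finset.mul_sum,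
            sum_univ_eq_first_add_middle_add_last hdf hdf0 hlast (fun j => ν j ^ (i + 1)),
            sum_univ_eq_first_add_middle_add_last hdf hdf0 hlast
              (fun j => ν j ^ i * (1 - ν j) * lam j ^ 2),
            hfirst, ← hw, ← hs2]
          simp only [ne_eq, Nat.add_eq_zero_iff, one_ne_zero, and_false, not_false_eq_true,
            zero_pow, sub_zero, mul_one]
          rw [← hfirst_term]
          linarith
    intro n
    have h := le_coeff_succ_of_logDeriv_ge hlast_pos.le hβ1 (derivative_cSeries df ν lam hν0)
      (by simpa [cSeries] using cCoef_nonneg df ν lam 0) hlow n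
    simp only [cSeries, coeff_mk] at h
    refine le_trans ?_ h
    have := cCoef_nonneg df ν lam n
    gcongr
  have hsucc0 : ∀ n : ℕ, (n + 1) * cCoef df ν (fun _ => 0) (n + 1) ≤
      (((df : ℝ) - 1) / 2 + n) * w * cCoef df ν (fun _ => 0) n := by
    intro n
    have h := coeff_succ_le_of_logDeriv_le (w := w) (β := ((df : ℝ) - 1) / 2)
      (derivative_cSeries df ν (fun _ => 0) hν0)
      (fun k => by simpa [cSeries] using cCoef_nonneg df ν (fun _ => 0) k) ?_ ?_ n
    · simpa only [cSeries, coeff_mk] using h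
    · rw [coeff_sum_halfSqLogDeriv _ hν1]
      have hle : ∑ j ∈ Finset.univ.erase (⟨0, hdf0⟩ : Fin df), ν j / 2 ≤
          ((df : ℝ) - 1) * (w / 2) := by
        refine (Finset.sum_le_card_nsmul _ _ (w / 2) fun j _ => ?_).trans_eq ?_
        · linarith [hνw j]
        · simp [Finset.card_erase_of_mem, Nat.cast_sub (show 1 ≤ df by omega)]
      have hsplit := Finset.add_sum_erase _ (fun j => ν j / 2)
        (Finset.mem_univ (⟨0, hdf0⟩ : Fin df))
      simp only [hfirst] at hsplit
      simp
      linarith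
    · intro i
      rw [coeff_sum_halfSqLogDeriv _ hν1, coeff_sum_halfSqLogDeriv _ hν1, Finset.mul_sum]
      refine Finset.sum_le_sum fun j _ => ?_
      have h := mul_le_mul_of_nonneg_left (hνw j) (pow_nonneg (hν0 j) (i + 1))
      simp
      rw [pow_succ _ (i + 1)]
      linarith
  intro m _
  refine Finset.sum_nonneg fun l hl => ?_
  have hlm : 2 * l < m := (Finset.mem_filter.mp hl).2
  have hlmR : 2 * (l : ℝ) < m := by exact_mod_cast hlm
  have hdf_half : (0 : ℝ) < (df : ℝ) / 2 := by positivity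
  refine mul_nonneg (div_nonneg (mul_nonneg (by linarith) (sq_nonneg _)) ?_) ?_
  · exact mul_nonneg (Real.Gamma_nonneg_of_nonneg (by positivity))
      (Real.Gamma_nonneg_of_nonneg (by positivity))
  · rw [sub_nonneg]
    refine mul_le_mul_of_ratio_bounds (r := fun n => (((df : ℝ) - 1) / 2 + n) * w)
      (cCoef_nonneg df ν lam) (cCoef_nonneg df ν _) (fun n => ?_) hsucc hsucc0 (by omega)
    have : (0 : ℝ) ≤ ((df : ℝ) - 1) / 2 := by linarith
    positivity
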